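/- arXiv:1609.01672 — 2 statements merged into one kernel-verified Lean document; each statement's English description precedes it below -/
import Mathlib

section
/- Let ν ∈ ℝ^{K×K} be an invertible matrix with rows ν₁ᵀ, …, ν_Kᵀ, let ρ ∈ ℝ^K satisfy ρ_k > 0 for all k and ∑_{k=1}^K ρ_k = 1, let R = diag(ρ₁, …, ρ_K), Δ = νᵀ R ν, and for x ∈ ℝ^K define Σ(x) = Δ⁻¹ (∑_{k=1}^K ρ_k ν_k ν_kᵀ (xᵀν_k − (xᵀν_k)²)) Δ⁻¹. Then for all indices 1 ≤ s, t ≤ K, νₛᵀ Σ(ν_t) νₛ = (1/ρₛ) · (ν_tᵀ νₛ) · (1 − ν_tᵀ νₛ). -/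
open Matrix

/-- Block-covariance identity (Lemma `mseForm`): with `Δ = νᵀ R ν` and
`Σ(x) = Δ⁻¹ (∑ₖ ρₖ νₖνₖᵀ (xᵀνₖ − (xᵀνₖ)²)) Δ⁻¹`, one has
`νₛᵀ Σ(ν_t) νₛ = (1/ρₛ)(ν_tᵀνₛ)(1 − ν_tᵀνₛ)`. -/
theorem block_covariance_identity
    (K : ℕ) (ν : Matrix (Fin K) (Fin K) ℝ) (hν : IsUnit ν.det)
    (ρ : Fin K → ℝ) (hρ : ∀ k, 0 < ρ k) (hρsum : ∑ k, ρ k = 1)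
    (R : Matrix (Fin K) (Fin K) ℝ) (hR : R = Matrix.diagonal ρ)
    (Δ : Matrix (Fin K) (Fin K) ℝ) (hΔ : Δ = νᵀ * R * ν)
    (Sig : (Fin K → ℝ) → Matrix (Fin K) (Fin K) ℝ)
    (hSig : ∀ x : Fin K → ℝ,
      Sig x = Δ⁻¹ * (∑ k, (ρ k * ((x ⬝ᵥ ν k) - (x ⬝ᵥ ν k) ^ 2)) •
        Matrix.vecMulVec (ν k) (ν k)) * Δ⁻¹) :
    ∀ s t : Fin K, ν s ⬝ᵥ (Sig (ν t) *ᵥ ν s) =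
      (1 / ρ s) * (ν t ⬝ᵥ ν s) * (1 - ν t ⬝ᵥ ν s) := by
  intro s t
  obtain ⟨w, hw⟩ : ∃ w, w = ν⁻¹ *ᵥ Pi.single s (1 / ρ s) := ⟨_, rfl⟩
  have hs : ρ s ≠ 0 := (hρ s).ne'
  have hνw : ν *ᵥ w = Pi.single s (1 / ρ s) := by
    rw [hw, mulVec_mulVec, Matrix.mul_nonsing_inv _ hν, one_mulVec]
  have hΔw : Δ *ᵥ w = ν s := by
    rw [hΔ, ← mulVec_mulVec, hνw, ← mulVec_mulVec, hR]
    have h1 : diagonal ρ *ᵥ (Pi.single s (1 / ρ s) : Fin K → ℝ) = Pi.single s 1 := by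
      ext j
      rw [mulVec_diagonal]
      by_cases h : j = s
      · subst h
        simp [hs]
      · simp [h]
    rw [h1]
    ext j
    simp
  have hRdet : IsUnit R.det := by
    rw [hR, det_diagonal]
    exact isUnit_iff_ne_zero.mpr (Finset.prod_ne_zero_iff.mpr fun k _ => (hρ k).ne')
  have hdet : IsUnit Δ.det := by
    rw [hΔ, det_mul, det_mul, det_transpose]
    exact (hν.mul hRdet).mul hν
  have hsym : Δᵀ = Δ := by
    rw [hΔ, hR]
    simp [Matrix.mul_assoc]
  have hinv : Δ⁻¹ *ᵥ ν s = w := by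
    rw [← hΔw, mulVec_mulVec, Matrix.nonsing_inv_mul _ hdet, one_mulVec]
  have hinv' : ν s ᵥ* Δ⁻¹ = w := by
    rw [← hinv, ← mulVec_transpose, transpose_nonsing_inv, hsym]
  have hk : ∀ k, ν k ⬝ᵥ w = (Pi.single s (1 / ρ s) : Fin K → ℝ) k := fun k =>
    congrFun hνw k
  rw [hSig, ← mulVec_mulVec, ← mulVec_mulVec, hinv, dotProduct_mulVec, hinv',
    sum_mulVec, dotProduct_sum]
  rw [Finset.sum_eq_single s]
  · rw [smul_mulVec, vecMulVec_mulVec, dotProduct_smul, hk, Pi.single_eq_same,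
      op_smul_eq_smul, dotProduct_smul, dotProduct_comm w, hk, Pi.single_eq_same]
    simp only [smul_eq_mul]
    field_simp
  · intro k _ hks
    rw [smul_mulVec, vecMulVec_mulVec, hk, Pi.single_eq_of_ne hks]
    simp
  · simp
end

section
/- Let A ∈ ℝ^{N×N} be symmetric with eigenvalues λ₁ ≥ λ₂ ≥ … ≥ λ_N and a corresponding orthonormal basis of eigenvectors u₁, …, u_N. For an integer 1 ≤ d ≤ N, define A_d⁺ = ∑_{i=1}^d max(λ_i, 0) · u_i u_iᵀ. Then A_d⁺ is positive semidefinite with rank(A_d⁺) ≤ d, and for every positive semidefinite matrix B ∈ ℝ^{N×N} with rank(B) ≤ d, ‖A − A_d⁺‖_F ≤ ‖A − B‖_F, where ‖·‖_F denotes the Frobenius norm. -/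
open Matrix

lemma aux_topd (N d : ℕ) (hd1 : 1 ≤ d) (hdN : d ≤ N) (p c : Fin N → ℝ)
    (hp : ∀ i j : Fin N, i ≤ j → p j ≤ p i) (hp0 : ∀ i, 0 ≤ p i)
    (hc0 : ∀ i, 0 ≤ c i) (hc1 : ∀ i, c i ≤ 1) (hcs : ∑ i, c i ≤ d) :
    ∑ i, p i * c i ≤ ∑ i : Fin N, if (i : ℕ) < d then p i else 0 := by
  set t := p ⟨d - 1, by omega⟩ with ht
  have h1 : ∀ i : Fin N, p i * c i - (if (i : ℕ) < d then p i else 0)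
      ≤ t * (c i - if (i : ℕ) < d then 1 else 0) := by
    intro i
    split_ifs with h
    · have : t ≤ p i := hp _ _ (by rw [Fin.le_def]; simp; omega)
      nlinarith [hc1 i]
    · have : p i ≤ t := hp _ _ (by rw [Fin.le_def]; simp; omega)
      nlinarith [hc0 i]
  have h2 := Finset.sum_le_sum (fun i (_ : i ∈ Finset.univ) => h1 i)
  rw [← Finset.mul_sum, Finset.sum_sub_distrib, Finset.sum_sub_distrib] at h2
  have h3 : ∑ i : Fin N, (if (i : ℕ) < d then (1 : ℝ) else 0) = d := by
    rw [Fin.sum_univ_eq_sum_range (fun i => if i < d then (1 : ℝ) else 0) N]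
    rw [Finset.sum_ite]
    have : (Finset.range N).filter (fun i => i < d) = Finset.range d := by
      ext i; simp; omega
    simp [this]
  rw [h3] at h2
  have h4 : 0 ≤ t := hp0 _
  nlinarith

lemma aux_frob {N : ℕ} (M : Matrix (Fin N) (Fin N) ℝ) :
    ∑ i, ∑ j, (M i j) ^ 2 = (Mᵀ * M).trace := by
  rw [Finset.sum_comm]
  simp [Matrix.trace, Matrix.mul_apply, sq]

lemma aux_conj {N : ℕ} (U M : Matrix (Fin N) (Fin N) ℝ) (hU : Uᵀ * U = 1) :
    ((U * M * Uᵀ)ᵀ * (U * M * Uᵀ)).trace = (Mᵀ * M).trace := by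
  have : (U * M * Uᵀ)ᵀ * (U * M * Uᵀ) = U * (Mᵀ * M * Uᵀ) := by
    simp only [Matrix.transpose_mul, Matrix.transpose_transpose]
    calc _ = U * Mᵀ * (Uᵀ * U) * M * Uᵀ := by simp only [Matrix.mul_assoc]
      _ = _ := by rw [hU]; simp only [Matrix.mul_assoc, Matrix.mul_one]
  rw [this, Matrix.trace_mul_comm, Matrix.mul_assoc, hU, Matrix.mul_one]

lemma aux_core (N d : ℕ) (hd1 : 1 ≤ d) (hdN : d ≤ N) (lam : Fin N → ℝ)
    (hdec : ∀ i j : Fin N, i ≤ j → lam j ≤ lam i)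
    (C : Matrix (Fin N) (Fin N) ℝ) (hC : C.PosSemidef) (hr : C.rank ≤ d) :
    ∑ i, (lam i) ^ 2 - ∑ i : Fin N, (if (i : ℕ) < d then (max (lam i) 0) ^ 2 else 0) ≤
      ((diagonal lam - C)ᵀ * (diagonal lam - C)).trace := by
  obtain ⟨V, μ, hV1, hV2, hμ, hcard, hCV⟩ : ∃ (V : Matrix (Fin N) (Fin N) ℝ) (μ : Fin N → ℝ),
      V * Vᵀ = 1 ∧ Vᵀ * V = 1 ∧ (∀ k, 0 ≤ μ k) ∧
      (Finset.univ.filter (fun k => μ k ≠ 0)).card ≤ d ∧ C = V * diagonal μ * Vᵀ := by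
    have hH := hC.isHermitian
    refine ⟨hH.eigenvectorUnitary, hH.eigenvalues, ?_, ?_, hC.eigenvalues_nonneg, ?_, ?_⟩
    · have := Unitary.mul_star_self_of_mem hH.eigenvectorUnitary.2
      simpa [Matrix.star_eq_conjTranspose] using this
    · have := Unitary.star_mul_self_of_mem hH.eigenvectorUnitary.2
      simpa [Matrix.star_eq_conjTranspose] using this
    · rw [hH.rank_eq_card_non_zero_eigs, Fintype.card_subtype] at hr
      exact hr
    · have := hH.spectral_theorem
      simpa [Unitary.conjStarAlgAut_apply, Matrix.star_eq_conjTranspose, Function.comp_def] using this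
  have hrow : ∀ i, ∑ k, V i k ^ 2 = 1 := by
    intro i
    have := congrFun (congrFun hV1 i) i
    simpa [Matrix.mul_apply, sq] using this
  have hcol : ∀ k, ∑ i, V i k ^ 2 = 1 := by
    intro k
    have := congrFun (congrFun hV2 k) k
    simpa [Matrix.mul_apply, sq] using this
  have hCt : Cᵀ = C := by
    rw [hCV]; simp [Matrix.mul_assoc]
  have hCC : (C * C).trace = ∑ k, μ k ^ 2 := by
    have : C * C = V * (diagonal μ * diagonal μ * Vᵀ) := by
      rw [hCV]
      calc _ = V * diagonal μ * (Vᵀ * V) * diagonal μ * Vᵀ := by simp only [Matrix.mul_assoc]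
        _ = _ := by rw [hV2]; simp only [Matrix.mul_assoc, Matrix.mul_one]
    rw [this, Matrix.trace_mul_comm, Matrix.mul_assoc, hV2, Matrix.mul_one]
    simp [sq, Matrix.trace]
  have hDC : (diagonal lam * C).trace = ∑ k, ∑ i, lam i * μ k * V i k ^ 2 := by
    rw [Finset.sum_comm]
    simp only [Matrix.trace, Matrix.diag, Matrix.diagonal_mul]
    refine Finset.sum_congr rfl fun i _ => ?_
    rw [hCV, Matrix.mul_apply, Finset.mul_sum]
    refine Finset.sum_congr rfl fun k _ => ?_
    rw [Matrix.mul_diagonal, Matrix.transpose_apply]; ring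
  have hexp : ((diagonal lam - C)ᵀ * (diagonal lam - C)).trace =
      ∑ i, (lam i) ^ 2 - 2 * ∑ k, ∑ i, lam i * μ k * V i k ^ 2 + ∑ k, μ k ^ 2 := by
    rw [Matrix.transpose_sub, hCt, Matrix.diagonal_transpose, Matrix.sub_mul, Matrix.mul_sub,
      Matrix.mul_sub, Matrix.trace_sub, Matrix.trace_sub, Matrix.trace_sub,
      Matrix.trace_mul_comm C (diagonal lam), hCC, hDC]
    simp only [Matrix.diagonal_mul_diagonal, Matrix.trace_diagonal, sq]
    ring
  rw [hexp]
  have hk : ∀ k, -(∑ i, (max (lam i) 0) ^ 2 * (if μ k ≠ 0 then V i k ^ 2 else 0)) ≤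
      μ k ^ 2 - 2 * ∑ i, lam i * μ k * V i k ^ 2 := by
    intro k
    by_cases h : μ k = 0
    · simp [h]
    · simp only [ne_eq, h, not_false_eq_true, if_true]
      have e : μ k ^ 2 = ∑ i, μ k ^ 2 * V i k ^ 2 := by rw [← Finset.mul_sum, hcol, mul_one]
      have : 0 ≤ ∑ i, (μ k ^ 2 * V i k ^ 2 - 2 * (lam i * μ k * V i k ^ 2)
          + (max (lam i) 0) ^ 2 * V i k ^ 2) := by
        refine Finset.sum_nonneg fun i _ => ?_
        have h1 : lam i * μ k ≤ max (lam i) 0 * μ k :=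
          mul_le_mul_of_nonneg_right (le_max_left _ _) (hμ k)
        have h2 : 0 ≤ μ k ^ 2 - 2 * (lam i * μ k) + (max (lam i) 0) ^ 2 := by
          nlinarith [sq_nonneg (μ k - max (lam i) 0)]
        nlinarith [mul_nonneg h2 (sq_nonneg (V i k))]
      rw [Finset.sum_add_distrib, Finset.sum_sub_distrib, ← e, ← Finset.mul_sum] at this
      linarith
  have hsum := Finset.sum_le_sum (fun k (_ : k ∈ Finset.univ) => hk k)
  rw [Finset.sum_sub_distrib, Finset.sum_neg_distrib, Finset.sum_comm, ← Finset.mul_sum] at hsum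
  have htop := aux_topd N d hd1 hdN (fun i => max (lam i) 0 ^ 2)
    (fun i => ∑ k, if μ k ≠ 0 then V i k ^ 2 else 0)
    (fun i j hij => pow_le_pow_left₀ (le_max_right _ _) (max_le_max_right 0 (hdec i j hij)) 2)
    (fun i => sq_nonneg _)
    (fun i => Finset.sum_nonneg fun k _ => by split_ifs <;> positivity)
    (fun i => by
      rw [← hrow i]
      refine Finset.sum_le_sum fun k _ => ?_
      split_ifs
      · exact le_rfl
      · positivity)
    (by
      rw [Finset.sum_comm]
      have : ∀ k, ∑ i, (if μ k ≠ 0 then V i k ^ 2 else 0) = if μ k ≠ 0 then (1 : ℝ) else 0 := by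
        intro k
        split_ifs
        · exact hcol k
        · simp
      simp only [this]
      rw [Finset.sum_boole]
      exact_mod_cast hcard)
  have e3 : ∑ i, ∑ k, max (lam i) 0 ^ 2 * (if μ k ≠ 0 then V i k ^ 2 else 0) =
      ∑ i, max (lam i) 0 ^ 2 * ∑ k, (if μ k ≠ 0 then V i k ^ 2 else 0) :=
    Finset.sum_congr rfl fun i _ => (Finset.mul_sum _ _ _).symm
  rw [e3] at hsum
  linarith

/-- The matrix built from the `d` algebraically largest eigenvalues (with negative
eigenvalues truncated to zero) and the corresponding orthonormal eigenvectors of a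
symmetric matrix `A` is the best rank-`d` positive semidefinite approximation of `A`
in Frobenius norm. -/
theorem best_rank_d_psd_approximation
    (N : ℕ) (A : Matrix (Fin N) (Fin N) ℝ) (hsymm : A.IsSymm)
    (lam : Fin N → ℝ) (u : Fin N → Fin N → ℝ)
    (hdec : ∀ i j : Fin N, i ≤ j → lam j ≤ lam i)
    (horth : ∀ i j : Fin N, u i ⬝ᵥ u j = if i = j then 1 else 0)
    (heig : ∀ i, A *ᵥ u i = lam i • u i)
    (d : ℕ) (hd1 : 1 ≤ d) (hdN : d ≤ N)
    (Adp : Matrix (Fin N) (Fin N) ℝ)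
    (hAdp : Adp = ∑ i ∈ Finset.univ.filter (fun i : Fin N => (i : ℕ) < d),
      max (lam i) 0 • Matrix.vecMulVec (u i) (u i))
    (frob : Matrix (Fin N) (Fin N) ℝ → ℝ)
    (hfrob : ∀ M : Matrix (Fin N) (Fin N) ℝ,
      frob M = Real.sqrt (∑ i, ∑ j, (M i j) ^ 2)) :
    Adp.PosSemidef ∧ Adp.rank ≤ d ∧
      ∀ B : Matrix (Fin N) (Fin N) ℝ, B.PosSemidef → B.rank ≤ d →
        frob (A - Adp) ≤ frob (A - B) := by
  set q : Fin N → ℝ := fun i => if (i : ℕ) < d then max (lam i) 0 else 0 with hq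
  set U : Matrix (Fin N) (Fin N) ℝ := Matrix.of u with hUdef
  have hU1 : U * Uᵀ = 1 := by
    ext i j
    have := horth i j
    simpa [Matrix.mul_apply, Matrix.one_apply, dotProduct, hUdef] using this
  have hU2 : Uᵀ * U = 1 := mul_eq_one_comm.mp hU1
  have hAd : Adp = Uᵀ * diagonal q * U := by
    rw [hAdp, Finset.sum_filter]
    ext a b
    rw [Matrix.mul_apply, Matrix.sum_apply]
    refine Finset.sum_congr rfl fun i _ => ?_
    rw [Matrix.mul_diagonal]
    simp only [hq]
    split_ifs
    · simp [vecMulVec_apply, hUdef]; ring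
    · simp
  have hAU : A * Uᵀ = Uᵀ * diagonal lam := by
    ext a i
    have := congrFun (heig i) a
    rw [Matrix.mul_diagonal]
    simpa [Matrix.mul_apply, Matrix.mulVec, dotProduct, hUdef, mul_comm] using this
  have hUA : U * A * Uᵀ = diagonal lam := by
    rw [Matrix.mul_assoc, hAU, ← Matrix.mul_assoc, hU1, Matrix.one_mul]
  have hUAd : U * Adp * Uᵀ = diagonal q := by
    rw [hAd]
    calc _ = (U * Uᵀ) * diagonal q * (U * Uᵀ) := by simp only [Matrix.mul_assoc]
      _ = _ := by rw [hU1, Matrix.one_mul, Matrix.mul_one]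
  have hq0 : ∀ i, 0 ≤ q i := fun i => by
    simp only [hq]; split_ifs
    · exact le_max_right _ _
    · exact le_rfl
  refine ⟨?_, ?_, ?_⟩
  · rw [hAd]
    have := (Matrix.PosSemidef.diagonal (n := Fin N) (d := q) hq0).conjTranspose_mul_mul_same U
    simpa using this
  · rw [hAd]
    refine (Matrix.rank_mul_le_left _ _).trans ((Matrix.rank_mul_le_right _ _).trans ?_)
    rw [Matrix.rank_diagonal, Fintype.card_subtype]
    calc _ ≤ (Finset.univ.filter (fun i : Fin N => (i : ℕ) < d)).card := by
          apply Finset.card_le_card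
          intro i
          simp only [hq, Finset.mem_filter, Finset.mem_univ, true_and]
          intro h
          by_contra h'
          simp [h'] at h
      _ ≤ (Finset.range d).card := by
          apply Finset.card_le_card_of_injOn (fun i : Fin N => (i : ℕ))
          · intro i; simp
          · exact Fin.val_injective.injOn
      _ = d := Finset.card_range d
  · intro B hB hBr
    rw [hfrob, hfrob]
    apply Real.sqrt_le_sqrt
    rw [aux_frob, aux_frob, ← aux_conj U (A - Adp) hU2, ← aux_conj U (A - B) hU2]
    simp only [Matrix.mul_sub, Matrix.sub_mul, hUA, hUAd]
    simp only [← Matrix.mul_sub, ← Matrix.sub_mul]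
    have hC : (U * B * Uᵀ).PosSemidef := by
      simpa using hB.mul_mul_conjTranspose_same U
    have hCr : (U * B * Uᵀ).rank ≤ d :=
      (Matrix.rank_mul_le_left _ _).trans ((Matrix.rank_mul_le_right _ _).trans hBr)
    refine le_trans (le_of_eq ?_) (aux_core N d hd1 hdN lam hdec _ hC hCr)
    rw [Matrix.diagonal_sub, Matrix.diagonal_transpose, Matrix.diagonal_mul_diagonal,
      Matrix.trace_diagonal, ← Finset.sum_sub_distrib]
    refine Finset.sum_congr rfl fun i _ => ?_
    simp only [hq]
    split_ifs with h
    · rcases max_cases (lam i) 0 with ⟨h, _⟩ | ⟨h, _⟩ <;> rw [h] <;> ring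
    · ring
end
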